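/- arXiv:1904.01165 — 2 statements merged into one kernel-verified Lean document; each statement's English description precedes it below -/
import Mathlib

section
/- For k ≠ 0 real and n ≥ 0, the alternating sum of k-Oresme numbers satisfies ∑_{j=0}^{n} (−1)^j A_j^{(k)} = (k²/(2k²+1))·(−1/k + (−1)^{n+1}(A_{n+2}^{(k)} − 2A_{n+1}^{(k)})). -/
theorem kOresme_alternating_sum (k : ℝ) (hk : k ≠ 0) (A : ℕ → ℝ)
    (h0 : A 0 = 0) (h1 : A 1 = 1/k)
    (hrec : ∀ n : ℕ, A (n+2) = A (n+1) - (1/k^2) * A n) :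
    ∀ n : ℕ, ∑ j ∈ Finset.range (n+1), (-1 : ℝ)^j * A j =
      (k^2 / (2*k^2 + 1)) * (-(1/k) + (-1 : ℝ)^(n+1) * (A (n+2) - 2 * A (n+1))) := by
  have hd : (2*k^2 + 1 : ℝ) ≠ 0 := by positivity
  intro n
  induction n with
  | zero =>
    have h2 := hrec 0
    simp only [zero_add] at h2
    simp only [zero_add, Finset.sum_range_one, h2, h0, h1]
    ring
  | succ n ih =>
    rw [Finset.sum_range_succ, ih]
    have h3 := hrec (n+1)
    have e : A (n+1+2) = A (n+1+1) - (1/k^2) * A (n+1) := h3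
    have e2 : A (n+2) = A (n+1+1) := rfl
    rw [e, e2, pow_succ (-1 : ℝ) (n+1)]
    generalize (-1 : ℝ)^(n+1) = s
    generalize A (n+1+1) = y
    generalize A (n+1) = x
    field_simp
    ring
end

section
/- For real x ≠ 0 and nonnegative integers n, r, s, the identity O_{n+r}(x)·O_{n+s}(x) − O_n(x)·O_{n+r+s}(x) = (1/x^{2n})·O_r(x)·O_s(x) holds. -/
noncomputable def oresme : ℕ → ℝ → ℝ
  | 0 => fun _ => 0
  | 1 => fun x => 1/x
  | (n+2) => fun x => oresme (n+1) x - (1/x^2) * oresme n x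

theorem oresme_rec (x : ℝ) (n : ℕ) :
    oresme (n+2) x = oresme (n+1) x - (1/x^2) * oresme n x := by
  simp only [oresme]

theorem oresme_one_case (x : ℝ) (s n : ℕ) :
    oresme (n+1) x * oresme (n+s) x - oresme n x * oresme (n+1+s) x =
      (1 / x^(2*n)) * oresme 1 x * oresme s x := by
  induction n with
  | zero => simp [oresme]
  | succ n ih =>
    have e1 : n+1+1 = n+2 := rfl
    have e2 : n+1+s = n+s+1 := by omega
    have e3 : n+2+s = n+s+2 := by omega
    have e4 : (1:ℝ) / x^(2*(n+1)) = (1/x^2) * (1 / x^(2*n)) := by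
      rw [div_mul_div_comm, one_mul, ← pow_add]
      congr 2
      ring
    rw [e2] at ih
    rw [e1, e2, e3, oresme_rec, oresme_rec, e4]
    linear_combination (1/x^2) * ih

theorem oresme_aux (x : ℝ) (n s : ℕ) : ∀ r : ℕ,
    oresme (n+r) x * oresme (n+s) x - oresme n x * oresme (n+r+s) x =
      (1 / x^(2*n)) * oresme r x * oresme s x
  | 0 => by simp [oresme]
  | 1 => oresme_one_case x s n
  | (r+2) => by
    have h0 := oresme_aux x n s r
    have h1 := oresme_aux x n s (r+1)
    have e1 : n+(r+2) = n+r+2 := rfl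
    have e2 : n+(r+1) = n+r+1 := rfl
    have e3 : n+r+2+s = n+r+s+2 := by omega
    have e4 : n+r+1+s = n+r+s+1 := by omega
    rw [e2, e4] at h1
    rw [e1, e3, oresme_rec, oresme_rec, oresme_rec]
    linear_combination h1 - (1/x^2) * h0

theorem oresme_index_identity (x : ℝ) (hx : x ≠ 0) (n r s : ℕ) :
    oresme (n+r) x * oresme (n+s) x - oresme n x * oresme (n+r+s) x =
      (1 / x^(2*n)) * oresme r x * oresme s x := by
  exact oresme_aux x n s r
end
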